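/- If W is a finite Sturmian palindrome of length N, then P_W(n) + P_W(N-n) = 2 for each 0 ≤ n ≤ N. -/

import Mathlib

open List

variable {α : Type*} [DecidableEq α]

/-- The set of factors (contiguous subwords) of `W`. -/
def factorFinset (W : List α) : Finset (List α) := (W.inits.flatMap List.tails).toFinset

/-- A palindrome is a word equal to its reversal. -/
def Pal (u : List α) : Prop := u.reverse = u

instance : DecidablePred (Pal : List α → Prop) :=
  fun u => inferInstanceAs (Decidable (u.reverse = u))

/-- The set of palindromic factors of `W` (including the empty word). -/
def palFactorFinset (W : List α) : Finset (List α) := (factorFinset W).filter Pal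

/-- Subword complexity: the number of distinct factors of `W` of length `n`. -/
def C (W : List α) (n : ℕ) : ℕ := ((factorFinset W).filter (fun u => u.length = n)).card

/-- Palindromic complexity: number of distinct palindromic factors of `W` of length `n`. -/
def P (W : List α) (n : ℕ) : ℕ := ((palFactorFinset W).filter (fun u => u.length = n)).card

/-- A word is rich if it has exactly `|W| + 1` distinct palindromic factors. -/
def Rich (W : List α) : Prop := (palFactorFinset W).card = W.length + 1

/-- Number of occurrences of `u` as a factor of `W`. -/
def occ (u W : List α) : ℕ := ((List.range (W.length + 1)).filter (fun i => u <+: W.drop i)).length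

/-- `Z` is a complete return to `u` in `W`: a factor of `W` with exactly two
occurrences of `u`, one as a prefix and one as a suffix. -/
def CompleteReturn (u Z W : List α) : Prop := Z <:+: W ∧ u <+: Z ∧ u <:+ Z ∧ occ u Z = 2

/-- `u` is a right special factor of `W`. -/
def RightSpecial (u W : List α) : Prop :=
  ∃ x y : α, x ≠ y ∧ (u ++ [x]) <:+: W ∧ (u ++ [y]) <:+: W

/-- `R_W`: the smallest `p` such that `W` has no right special factor of length `p`. -/
noncomputable def RW (W : List α) : ℕ := sInf {p : ℕ | ∀ u : List α, u.length = p → ¬ RightSpecial u W}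

/-- `K_W`: the length of the shortest suffix of `W` occurring exactly once in `W`. -/
noncomputable def KW (W : List α) : ℕ := sInf {k : ℕ | ∃ u : List α, u <:+ W ∧ u.length = k ∧ occ u W = 1}

/-- A word is trapezoidal if `|W| = R_W + K_W`. -/
def Trapezoidal (W : List α) : Prop := W.length = RW W + KW W

/-- The minimal period of `W`. -/
noncomputable def minPeriod (W : List α) : ℕ :=
  sInf {q : ℕ | 0 < q ∧ ∀ i : ℕ, i + q < W.length → W[i]? = W[i + q]?}

/-- A binary word is balanced if the number of occurrences of a letter in two
factors of equal length differ by at most 1. -/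
def BalancedWord (W : List Bool) : Prop :=
  ∀ u v : List Bool, u <:+: W → v <:+: W → u.length = v.length →
    u.count true ≤ v.count true + 1

theorem mem_palFactorFinset {W u : List α} :
    u ∈ palFactorFinset W ↔ u <:+: W ∧ Pal u := by
  simp only [palFactorFinset, factorFinset, Finset.mem_filter, List.mem_toFinset,
    List.mem_flatMap, List.mem_inits, List.mem_tails]
  rw [List.infix_iff_suffix_prefix]
  exact and_congr_left fun _ => exists_congr fun _ => and_comm

theorem palFactorFinset_reverse (W : List α) :
    palFactorFinset W.reverse = palFactorFinset W := by
  ext u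
  simp only [mem_palFactorFinset]
  refine and_congr_left fun h => ?_
  rw [← List.reverse_infix, List.reverse_reverse]
  rw [show u.reverse = u from h]

/-- Prepending a letter creates at most one new palindromic factor. -/
theorem card_palFactorFinset_cons_le (x : α) (U : List α) :
    (palFactorFinset (x :: U)).card ≤ (palFactorFinset U).card + 1 := by
  have hone : (palFactorFinset (x :: U) \ palFactorFinset U).card ≤ 1 := by
    have key : ∀ u v : List α, u <+: x :: U → v <+: x :: U → Pal u → Pal v →
        u.length < v.length → u <:+: U := by
      intro u v hu hv pu pv hlt
      have huv : u <+: v := List.prefix_of_prefix_length_le hu hv hlt.le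
      have hsuf : u <:+ v := by
        have := List.reverse_suffix.mpr huv
        rwa [show u.reverse = u from pu, show v.reverse = v from pv] at this
      obtain ⟨s, rfl⟩ := hsuf
      cases s with
      | nil => simp at hlt
      | cons y s =>
        rw [List.cons_append, List.cons_prefix_cons] at hv
        exact (List.suffix_append s u).isInfix.trans hv.2.isInfix
    rw [Finset.card_le_one]
    have pre : ∀ u, u ∈ palFactorFinset (x :: U) \ palFactorFinset U →
        u <+: x :: U ∧ Pal u ∧ ¬ u <:+: U := by
      intro u hu
      simp only [Finset.mem_sdiff, mem_palFactorFinset, not_and] at hu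
      have hn : ¬ u <:+: U := fun h => hu.2 h hu.1.2
      exact ⟨(List.infix_cons_iff.mp hu.1.1).resolve_right hn, hu.1.2, hn⟩
    intro u hu v hv
    obtain ⟨hu, pu, nu⟩ := pre u hu
    obtain ⟨hv, pv, nv⟩ := pre v hv
    rcases lt_trichotomy u.length v.length with h | h | h
    · exact absurd (key u v hu hv pu pv h) nu
    · exact (List.prefix_of_prefix_length_le hu hv h.le).eq_of_length h
    · exact absurd (key v u hv hu pv pu h) nv
  have := Finset.card_le_card_sdiff_add_card (s := palFactorFinset (x :: U))
    (t := palFactorFinset U)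
  omega

theorem card_palFactorFinset_append_left_le (s U : List α) :
    (palFactorFinset (s ++ U)).card ≤ (palFactorFinset U).card + s.length := by
  induction s with
  | nil => simp
  | cons x s ih =>
    have := card_palFactorFinset_cons_le x (s ++ U)
    simp only [List.cons_append, List.length_cons]
    omega

theorem card_palFactorFinset_le (W : List α) :
    (palFactorFinset W).card ≤ W.length + 1 := by
  have h := card_palFactorFinset_append_left_le W []
  have h0 : (palFactorFinset ([] : List α)).card ≤ 1 := by
    rw [Finset.card_le_one]
    intro u hu v hv
    rw [mem_palFactorFinset, List.infix_nil] at hu hv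
    rw [hu.1, hv.1]
  rw [List.append_nil] at h
  omega

theorem card_palFactorFinset_of_infix {W V : List α} (h : W <:+: V)
    (hV : V.length + 1 ≤ (palFactorFinset V).card) :
    W.length + 1 ≤ (palFactorFinset W).card := by
  obtain ⟨s, t, rfl⟩ := h
  have h1 := card_palFactorFinset_append_left_le s (W ++ t)
  have h2 := card_palFactorFinset_append_left_le t.reverse W.reverse
  rw [← List.reverse_append, palFactorFinset_reverse, palFactorFinset_reverse,
    List.length_reverse] at h2
  simp only [List.append_assoc, List.length_append] at *
  omega

theorem Pal.exists_central {u : List Bool} (hu : Pal u) {m : ℕ} (hm : m ≤ u.length)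
    (hpar : m % 2 = u.length % 2) :
    ∃ v, v <:+: u ∧ Pal v ∧ v.length = m ∧ v.count true % 2 = u.count true % 2 := by
  have hp := List.Palindrome.of_reverse_eq hu
  clear hu
  induction hp with
  | nil => exact ⟨[], List.infix_rfl, rfl, by simp at hm ⊢; omega, rfl⟩
  | singleton x => exact ⟨[x], List.infix_rfl, rfl, by simp at hm hpar ⊢; omega, rfl⟩
  | @cons_concat x l hl ih =>
    simp only [List.length_cons, List.length_append, List.length_nil] at hm hpar
    rcases Nat.lt_or_ge l.length m with h | h
    · refine ⟨x :: (l ++ [x]), List.infix_rfl, (hl.cons_concat x).reverse_eq, ?_, rfl⟩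
      simp only [List.length_cons, List.length_append, List.length_nil]
      omega
    · obtain ⟨v, hv, pv, lv, cv⟩ := ih h (by omega)
      refine ⟨v, hv.trans ⟨[x], [x], by simp⟩, pv, lv, ?_⟩
      rw [cv]
      simp only [List.count_cons, List.count_append, List.count_nil]
      split <;> omega

theorem Pal.count_even {u : List Bool} (hu : Pal u) (hl : u.length % 2 = 0) :
    u.count true % 2 = 0 := by
  obtain ⟨v, -, -, lv, cv⟩ := hu.exists_central (Nat.zero_le _) (by omega : 0 % 2 = u.length % 2)
  rw [List.length_eq_zero_iff] at lv
  subst lv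
  simpa using cv.symm

theorem BalancedWord.pal_unique {W : List Bool} (hbal : BalancedWord W) {u v : List Bool}
    (hu : u <:+: W) (hv : v <:+: W) (pu : Pal u) (pv : Pal v) (hl : u.length = v.length)
    (hc : u.count true % 2 = v.count true % 2) : u = v := by
  have hu' := List.Palindrome.of_reverse_eq pu
  have hv' := List.Palindrome.of_reverse_eq pv
  clear pu pv
  induction hu' generalizing v with
  | nil => exact (List.length_eq_zero_iff.mp hl.symm).symm
  | singleton x =>
    obtain ⟨y, rfl⟩ := List.length_eq_one_iff.mp hl.symm
    revert hc
    cases x <;> cases y <;> simp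
  | @cons_concat x l h ih =>
    cases hv' with
    | nil => simp at hl
    | singleton y => simp at hl
    | @cons_concat y l' h' =>
      have il : l <:+: W := List.IsInfix.trans ⟨[x], [x], by simp⟩ hu
      have il' : l' <:+: W := List.IsInfix.trans ⟨[y], [y], by simp⟩ hv
      simp only [List.length_cons, List.length_append, List.length_nil] at hl
      have b1 := hbal _ _ hu hv (by simp; omega)
      have b2 := hbal _ _ hv hu (by simp; omega)
      have b3 := hbal _ _ il il' (by omega)
      have b4 := hbal _ _ il' il (by omega)
      have key : x = y ∧ l.count true % 2 = l'.count true % 2 := by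
        simp only [List.count_cons, List.count_append, List.count_nil] at hc b1 b2
        cases x <;> cases y <;> simp at hc b1 b2 ⊢ <;> omega
      have hll : l = l' := ih il il' (by omega) key.2 h'
      rw [key.1, hll]

/-- The palindromic factors of `W` whose length is congruent to `a` and whose number of
`true`s is congruent to `b` modulo `2`. -/
def palClass (W : List Bool) (a b : ℕ) : Finset (List Bool) :=
  (palFactorFinset W).filter fun u => u.length % 2 = a ∧ u.count true % 2 = b

theorem mem_palClass {W u : List Bool} {a b : ℕ} :
    u ∈ palClass W a b ↔
      (u <:+: W ∧ Pal u) ∧ u.length % 2 = a ∧ u.count true % 2 = b := by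
  rw [palClass, Finset.mem_filter, mem_palFactorFinset]

theorem card_palFactorFinset_eq (W : List Bool) :
    (palFactorFinset W).card =
      (palClass W 0 0).card + (palClass W 1 0).card + (palClass W 1 1).card := by
  have hd : Disjoint (palClass W 0 0) (palClass W 1 0) := by
    rw [Finset.disjoint_left]
    intro u hu hv
    rw [mem_palClass] at hu hv
    omega
  have hd' : Disjoint (palClass W 0 0 ∪ palClass W 1 0) (palClass W 1 1) := by
    rw [Finset.disjoint_left]
    intro u hu hv
    rw [Finset.mem_union, mem_palClass, mem_palClass] at hu
    rw [mem_palClass] at hv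
    omega
  rw [← Finset.card_union_of_disjoint hd, ← Finset.card_union_of_disjoint hd']
  congr 1
  ext u
  simp only [Finset.mem_union, mem_palClass, mem_palFactorFinset]
  constructor
  · intro h
    have := h.2.count_even
    rcases Nat.mod_two_eq_zero_or_one u.length with h1 | h1 <;>
      rcases Nat.mod_two_eq_zero_or_one (u.count true) with h2 | h2 <;> simp_all
  · rintro ((h | h) | h) <;> exact h.1

theorem lt_card_palClass {W u : List Bool} (hu : u <:+: W) (pu : Pal u) :
    u.length / 2 < (palClass W (u.length % 2) (u.count true % 2)).card := by
  have hsub : Finset.range (u.length / 2 + 1) ⊆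
      (palClass W (u.length % 2) (u.count true % 2)).image fun v => v.length / 2 := by
    intro k hk
    rw [Finset.mem_range] at hk
    obtain ⟨v, hv, pv, lv, cv⟩ :=
      pu.exists_central (m := 2 * k + u.length % 2) (by omega) (by omega)
    rw [Finset.mem_image]
    exact ⟨v, mem_palClass.mpr ⟨⟨hv.trans hu, pv⟩, by omega, cv⟩, by omega⟩
  have h1 := Finset.card_le_card hsub
  have h2 := Finset.card_image_le (s := palClass W (u.length % 2) (u.count true % 2))
    (f := fun v => v.length / 2)
  rw [Finset.card_range] at h1
  omega

theorem BalancedWord.card_filter_palClass {W : List Bool} (hbal : BalancedWord W)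
    {a : ℕ} (b k : ℕ) (ha : a < 2) :
    ((palClass W a b).filter fun u => u.length = 2 * k + a).card =
      if k < (palClass W a b).card then 1 else 0 := by
  split_ifs with h
  · have hle : ((palClass W a b).filter fun u => u.length = 2 * k + a).card ≤ 1 := by
      rw [Finset.card_le_one]
      intro u hu v hv
      rw [Finset.mem_filter, mem_palClass] at hu hv
      exact hbal.pal_unique hu.1.1.1 hv.1.1.1 hu.1.1.2 hv.1.1.2 (by omega) (by omega)
    suffices ((palClass W a b).filter fun u => u.length = 2 * k + a).Nonempty by
      have := this.card_pos
      omega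
    by_contra hne
    rw [Finset.not_nonempty_iff_eq_empty, Finset.filter_eq_empty_iff] at hne
    have hmaps : ∀ u ∈ palClass W a b, u.length / 2 ∈ Finset.range k := by
      intro u hu
      rw [Finset.mem_range]
      by_contra hk
      have hu' := mem_palClass.mp hu
      obtain ⟨v, hv, pv, lv, cv⟩ :=
        hu'.1.2.exists_central (m := 2 * k + a) (by omega) (by omega)
      exact hne (mem_palClass.mpr ⟨⟨hv.trans hu'.1.1, pv⟩, by omega, by omega⟩) lv
    have := Finset.card_le_card_of_injOn (fun u : List Bool => u.length / 2) hmaps (by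
      intro u hu v hv huv
      rw [Finset.mem_coe, mem_palClass] at hu hv
      dsimp only at huv
      exact hbal.pal_unique hu.1.1 hv.1.1 hu.1.2 hv.1.2 (by omega) (by omega))
    rw [Finset.card_range] at this
    omega
  · rw [Finset.card_eq_zero, Finset.filter_eq_empty_iff]
    intro u hu hl
    obtain ⟨⟨iu, pu⟩, h1, h2⟩ := mem_palClass.mp hu
    have := lt_card_palClass iu pu
    rw [h1, h2] at this
    omega

theorem P_eq_card_palClass (W : List Bool) {a : ℕ} (k : ℕ) (ha : a < 2) :
    P W (2 * k + a) =
      ((palClass W a 0).filter fun u => u.length = 2 * k + a).card +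
      ((palClass W a 1).filter fun u => u.length = 2 * k + a).card := by
  rw [P, ← Finset.card_union_of_disjoint]
  · congr 1
    ext u
    simp only [Finset.mem_union, Finset.mem_filter, mem_palClass, mem_palFactorFinset]
    constructor
    · intro h
      rcases Nat.mod_two_eq_zero_or_one (u.count true) with h2 | h2
      · exact Or.inl ⟨⟨h.1, by omega, h2⟩, h.2⟩
      · exact Or.inr ⟨⟨h.1, by omega, h2⟩, h.2⟩
    · rintro (h | h) <;> exact ⟨h.1.1, h.2⟩
  · rw [Finset.disjoint_left]
    intro u hu hv
    rw [Finset.mem_filter, mem_palClass] at hu hv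
    omega

theorem card_palClass_zero_one (W : List Bool) : (palClass W 0 1).card = 0 := by
  rw [Finset.card_eq_zero, Finset.eq_empty_iff_forall_notMem]
  intro u hu
  have hu' := mem_palClass.mp hu
  have := hu'.1.2.count_even hu'.2.1
  omega

/-- In a balanced rich palindrome the palindromic complexity is symmetric. -/
theorem BalancedWord.P_add_P_of_rich {W : List Bool} (hbal : BalancedWord W) (hpal : Pal W)
    (hrich : (palFactorFinset W).card = W.length + 1) {n : ℕ} (hn : n ≤ W.length) :
    P W n + P W (W.length - n) = 2 := by
  have hP : ∀ m, P W m =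
      (if m / 2 < (palClass W (m % 2) 0).card then 1 else 0) +
      (if m / 2 < (palClass W (m % 2) 1).card then 1 else 0) := by
    intro m
    have h2 : m % 2 < 2 := Nat.mod_lt _ two_pos
    rw [← hbal.card_filter_palClass 0 _ h2, ← hbal.card_filter_palClass 1 _ h2,
      ← P_eq_card_palClass W _ h2, Nat.div_add_mod]
  have htop := lt_card_palClass List.infix_rfl hpal
  have hle : ∀ b, (palClass W (W.length % 2) b).card ≤ W.length / 2 + 1 := by
    intro b
    by_contra hb
    have h := hbal.card_filter_palClass (W := W) b (W.length / 2 + 1)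
      (Nat.mod_lt W.length two_pos)
    rw [if_pos (by omega)] at h
    obtain ⟨u, hu⟩ := Finset.card_pos.mp (by omega :
      0 < ((palClass W (W.length % 2) b).filter
        fun u => u.length = 2 * (W.length / 2 + 1) + W.length % 2).card)
    rw [Finset.mem_filter, mem_palClass] at hu
    have := hu.1.1.1.length_le
    omega
  rw [card_palFactorFinset_eq] at hrich
  have h01 := card_palClass_zero_one W
  rw [hP, hP]
  have hle0 := hle 0
  have hle1 := hle 1
  rcases Nat.mod_two_eq_zero_or_one W.length with hN | hN <;>
    rcases Nat.mod_two_eq_zero_or_one (W.count true) with hH | hH <;>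
    rcases Nat.mod_two_eq_zero_or_one n with hn2 | hn2
  all_goals
    first
    | rw [show (W.length - n) % 2 = 0 by omega]
    | rw [show (W.length - n) % 2 = 1 by omega]
    rw [hN, hH] at htop
    rw [hN] at hle0 hle1
    rw [hn2]
    split_ifs <;> omega

/-- The word of length `n` whose `i`-th letter tells whether `F` increases at `i`. -/
def incrementWord (F : ℕ → ℕ) (n : ℕ) : List Bool :=
  (List.range n).map fun i => decide (F i < F (i + 1))

/-- The central word of slope `p / q`. -/
def centralWord (p q : ℕ) : List Bool := incrementWord (fun i => (i + 1) * p / q) (q - 2)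

theorem length_incrementWord (F : ℕ → ℕ) (n : ℕ) : (incrementWord F n).length = n := by
  simp [incrementWord]

theorem count_incrementWord (F : ℕ → ℕ) (n : ℕ)
    (hF : ∀ i < n, F i ≤ F (i + 1) ∧ F (i + 1) ≤ F i + 1) :
    F 0 + (incrementWord F n).count true = F n := by
  induction n with
  | zero => simp [incrementWord]
  | succ n ih =>
    have h1 := ih fun i hi => hF i (by omega)
    have h2 := hF n (by omega)
    rw [incrementWord, List.range_succ, List.map_append, List.count_append,
      ← incrementWord, ← Nat.add_assoc, h1]
    by_cases h : F n < F (n + 1)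
    · simp [h]; omega
    · simp [h]; omega

theorem incrementWord_congr {F G : ℕ → ℕ} {n : ℕ} (h : ∀ i ≤ n, F i = G i) :
    incrementWord F n = incrementWord G n := by
  refine List.map_congr_left fun i hi => ?_
  rw [List.mem_range] at hi
  rw [h i (by omega), h (i + 1) (by omega)]

theorem incrementWord_shift_infix (F : ℕ → ℕ) {s m n : ℕ} (h : s + m ≤ n) :
    incrementWord (fun i => F (s + i)) m <:+: incrementWord F n := by
  obtain ⟨t, rfl⟩ := Nat.exists_eq_add_of_le h
  refine ⟨incrementWord F s, incrementWord (fun i => F (s + m + i)) t, ?_⟩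
  simp only [incrementWord, List.range_add, List.map_append, List.map_map]
  rfl

theorem incrementWord_infix_of_le (F : ℕ → ℕ) {m n : ℕ} (h : m ≤ n) :
    incrementWord F m <:+: incrementWord F n := by
  simpa using incrementWord_shift_infix F (s := 0) (m := m) (n := n) (by omega)

theorem floor_step {p q : ℕ} (hpq : p < q) (i : ℕ) :
    i * p / q ≤ (i + 1) * p / q ∧ (i + 1) * p / q ≤ i * p / q + 1 := by
  constructor
  · exact Nat.div_le_div_right (Nat.mul_le_mul_right _ (Nat.le_succ i))
  · rw [← Nat.add_div_right _ (by omega : 0 < q), Nat.succ_mul]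
    exact Nat.div_le_div_right (by omega)

theorem floor_complement {p q j : ℕ} (hcop : Nat.Coprime p q) (hj : 0 < j) (hjq : j < q)
    (hp : 0 < p) : j * p / q + (q - j) * p / q + 1 = p := by
  have hq : 0 < q := by omega
  obtain ⟨i, rfl⟩ := Nat.exists_eq_add_of_lt hjq
  have hr : 0 < j * p % (j + i + 1) := by
    rw [Nat.pos_iff_ne_zero]
    intro h
    have hd : j + i + 1 ∣ j := hcop.symm.dvd_of_dvd_mul_right (Nat.dvd_of_mod_eq_zero h)
    have := Nat.le_of_dvd hj hd
    omega
  have hr' := Nat.mod_lt (j * p) hq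
  have hdm := Nat.div_add_mod (j * p) (j + i + 1)
  generalize j * p / (j + i + 1) = f at *
  generalize j * p % (j + i + 1) = r at *
  have hf : f < p := by
    have : (j + i + 1) * f < (j + i + 1) * p := by nlinarith
    exact Nat.lt_of_mul_lt_mul_left this
  obtain ⟨e, rfl⟩ := Nat.exists_eq_add_of_lt hf
  have he : (j + i + 1 - j) * (f + e + 1) / (j + i + 1) = e := by
    rw [show j + i + 1 - j = i + 1 by omega]
    apply Nat.div_eq_of_lt_le <;> nlinarith
  omega

theorem centralWord_pal {p q : ℕ} (hcop : Nat.Coprime p q) (hp : 0 < p) :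
    Pal (centralWord p q) := by
  refine List.ext_getElem (by simp) fun i h1 h2 => ?_
  simp only [centralWord, length_incrementWord] at h2
  have a1 := floor_complement hcop (j := i + 1) (by omega) (by omega) hp
  have a2 := floor_complement hcop (j := i + 2) (by omega) (by omega) hp
  simp only [centralWord, incrementWord, List.getElem_reverse, List.length_map,
    List.length_range, List.getElem_map, List.getElem_range]
  rw [show q - 2 - 1 - i + 1 + 1 = q - (i + 1) by omega,
    show q - 2 - 1 - i + 1 = q - (i + 2) by omega, show i + 1 + 1 = i + 2 by omega,
    decide_eq_decide]
  omega

theorem length_centralWord (p q : ℕ) : (centralWord p q).length = q - 2 :=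
  length_incrementWord _ _

theorem count_centralWord {p q : ℕ} (hcop : Nat.Coprime p q) (hp : 0 < p) (hpq : p < q) :
    (centralWord p q).count true + 1 = p := by
  have h := count_incrementWord (fun i => (i + 1) * p / q) (q - 2)
    fun i _ => floor_step hpq (i + 1)
  have h1 := floor_complement hcop (j := 1) one_pos (by omega) hp
  simp only [zero_add, one_mul, show q - 2 + 1 = q - 1 by omega,
    Nat.div_eq_of_lt hpq] at h h1
  rw [centralWord]
  omega

theorem centralWord_infix_add_left {p q p' q' : ℕ} (h : p * q' = q * p' + 1) (hq : 2 ≤ q) :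
    centralWord p q <:+: centralWord (p + p') (q + q') := by
  refine List.IsInfix.trans (l₂ := incrementWord (fun i => (i + 1) * (p + p') / (q + q')) (q - 2))
    ?_ (incrementWord_infix_of_le _ (by omega))
  rw [centralWord, incrementWord_congr]
  intro i hi
  have hdm := Nat.div_add_mod ((i + 1) * (p + p')) (q + q')
  have hr := Nat.mod_lt ((i + 1) * (p + p')) (by omega : 0 < q + q')
  set f := (i + 1) * (p + p') / (q + q')
  set r := (i + 1) * (p + p') % (q + q')
  obtain ⟨e, he⟩ : ∃ e, q = i + 1 + 1 + e := ⟨q - (i + 2), by omega⟩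
  have key : (q + q') * ((i + 1) * p) = q * ((q + q') * f) + q * r + (i + 1) := by
    linear_combination (i + 1) * h - q * hdm
  apply Nat.div_eq_of_lt_le
  · refine Nat.le_of_mul_le_mul_left ?_ (by omega : 0 < q + q')
    nlinarith
  · refine Nat.lt_of_mul_lt_mul_left (a := q + q') ?_
    nlinarith

theorem centralWord_infix_add_right {p q p' q' : ℕ} (h : p * q' = q * p' + 1) (hq' : 2 ≤ q') :
    centralWord p' q' <:+: centralWord (p + p') (q + q') := by
  refine List.IsInfix.trans
    (l₂ := incrementWord (fun i => (i + 1) * (p + p') / (q + q')) (q' - 2))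
    ?_ (incrementWord_infix_of_le _ (by omega))
  rw [centralWord, incrementWord_congr]
  intro i hi
  have hdm := Nat.div_add_mod ((i + 1) * (p + p')) (q + q')
  have hr := Nat.mod_lt ((i + 1) * (p + p')) (by omega : 0 < q + q')
  set f := (i + 1) * (p + p') / (q + q')
  set r := (i + 1) * (p + p') % (q + q')
  have key : (q + q') * ((i + 1) * p') + (i + 1) = q' * ((q + q') * f) + q' * r := by
    have h1 : (i + 1) * (p * q') = (i + 1) * (q * p' + 1) := by rw [h]
    have h2 : q' * ((q + q') * f + r) = q' * ((i + 1) * (p + p')) := by rw [hdm]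
    linarith
  have hi' : i + 1 < q' := by omega
  apply Nat.div_eq_of_lt_le
  · by_contra hlt
    rw [not_le] at hlt
    have : (q + q') * ((i + 1) * p' + 1) ≤ (q + q') * (f * q') := Nat.mul_le_mul_left _ hlt
    nlinarith
  · refine Nat.lt_of_mul_lt_mul_left (a := q + q') ?_
    nlinarith

theorem coprime_of_det {p q p' q' : ℕ} (h : p * q' = q * p' + 1) : Nat.Coprime p q := by
  have h1 : p.gcd q ∣ p * q' := (Nat.gcd_dvd_left p q).mul_right _
  have h2 : p.gcd q ∣ q * p' := (Nat.gcd_dvd_right p q).mul_right _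
  rw [h] at h1
  exact Nat.dvd_one.mp ((Nat.dvd_add_right h2).mp h1)

theorem centralWord_rich {p q p' q' : ℕ} (h : p * q' = q * p' + 1) (hp : 0 < p) (hpq : p < q)
    (hp' : 0 < p') (hpq' : p' < q') :
    (centralWord (p + p') (q + q')).length + 1 ≤
      (palFactorFinset (centralWord (p + p') (q + q'))).card := by
  have c1 : Nat.Coprime p q := coprime_of_det h
  have c2 : Nat.Coprime p' q' := (coprime_of_det (p := q') (q := p') (p' := q) (q' := p)
    (by linarith)).symm
  have c3 : Nat.Coprime (p + p') (q + q') :=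
    coprime_of_det (p' := p') (q' := q') (by linarith)
  have b1 := lt_card_palClass (centralWord_infix_add_left h (by omega)) (centralWord_pal c1 hp)
  have b2 := lt_card_palClass (centralWord_infix_add_right h (by omega)) (centralWord_pal c2 hp')
  have b3 := lt_card_palClass List.infix_rfl
    (centralWord_pal (p := p + p') (q := q + q') c3 (by omega))
  have n1 := count_centralWord c1 hp hpq
  have n2 := count_centralWord c2 hp' hpq'
  have n3 := count_centralWord c3 (by omega) (by omega)
  have m1 := (centralWord_pal c1 hp).count_even
  have m2 := (centralWord_pal c2 hp').count_even
  have m3 := (centralWord_pal (p := p + p') (q := q + q') c3 (by omega)).count_even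
  rw [card_palFactorFinset_eq]
  rw [length_centralWord] at *
  have hdet : p * q' % 2 = (q * p' + 1) % 2 := by rw [h]
  rw [Nat.add_mod, Nat.mul_mod p, Nat.mul_mod q] at hdet
  rw [show (q - 2) % 2 = q % 2 by omega] at b1 m1
  rw [show (q' - 2) % 2 = q' % 2 by omega] at b2 m2
  rw [show (q + q' - 2) % 2 = (q + q') % 2 by omega] at b3 m3
  rw [show (centralWord p q).count true % 2 = (p + 1) % 2 by omega] at b1
  rw [show (centralWord p' q').count true % 2 = (p' + 1) % 2 by omega] at b2
  rw [show (centralWord (p + p') (q + q')).count true % 2 = (p + p' + 1) % 2 by omega] at b3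
  generalize centralWord (p + p') (q + q') = V at *
  rw [Nat.add_mod] at b1 b2
  rw [Nat.add_mod q, Nat.add_mod _ 1, Nat.add_mod p] at b3
  rcases Nat.mod_two_eq_zero_or_one p with x1 | x1 <;>
    rcases Nat.mod_two_eq_zero_or_one q with x2 | x2 <;>
    rcases Nat.mod_two_eq_zero_or_one p' with x3 | x3 <;>
    rcases Nat.mod_two_eq_zero_or_one q' with x4 | x4 <;>
    rw [x1, x2, x3, x4] at hdet <;> norm_num at hdet <;>
    rw [x1, x2] at b1 <;> rw [x3, x4] at b2 <;> rw [x1, x2, x3, x4] at b3 <;>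
    norm_num at b1 b2 b3 <;> omega

/-- In a balanced word the slopes of two nonempty factors `u`, `v` differ by less than
`1 / |u| + 1 / |v|`. -/
theorem BalancedWord.slope_lt {W : List Bool} (hbal : BalancedWord W) {u v : List Bool}
    (hu : u <:+: W) (hv : v <:+: W) (hu0 : 0 < u.length) (hv0 : 0 < v.length) :
    u.count true * v.length < v.count true * u.length + u.length + v.length := by
  induction hn : u.length + v.length using Nat.strong_induction_on generalizing u v with
  | _ n ih =>
    rcases lt_trichotomy u.length v.length with h | h | h
    · have hz : v.take u.length <:+: W := (List.take_prefix _ _).isInfix.trans hv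
      have ht : v.drop u.length <:+: W := (List.drop_suffix _ _).isInfix.trans hv
      have lz : (v.take u.length).length = u.length := by simp; omega
      have lt : (v.drop u.length).length = v.length - u.length := by simp
      have hb := hbal u _ hu hz lz.symm
      have hi := ih _ (by omega) hu ht hu0 (by omega) rfl
      have hc : (v.take u.length).count true + (v.drop u.length).count true
          = v.count true := by
        rw [← List.count_append, List.take_append_drop]
      obtain ⟨e, he⟩ := Nat.exists_eq_add_of_lt h
      rw [lt, he, show u.length + e + 1 - u.length = e + 1 by omega] at hi
      rw [← hc, he]
      nlinarith
    · have hb := hbal u v hu hv h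
      rw [h] at *
      nlinarith
    · have hz : u.take v.length <:+: W := (List.take_prefix _ _).isInfix.trans hu
      have ht : u.drop v.length <:+: W := (List.drop_suffix _ _).isInfix.trans hu
      have lz : (u.take v.length).length = v.length := by simp; omega
      have lt : (u.drop v.length).length = u.length - v.length := by simp
      have hb := hbal _ v hz hv lz
      have hi := ih _ (by omega) ht hv (by omega) hv0 rfl
      have hc : (u.take v.length).count true + (u.drop v.length).count true
          = u.count true := by
        rw [← List.count_append, List.take_append_drop]
      obtain ⟨e, he⟩ := Nat.exists_eq_add_of_lt h
      rw [lt, he, show v.length + e + 1 - v.length = e + 1 by omega] at hi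
      rw [← hc, he]
      nlinarith

/-- Points `(d, g)` whose slopes are pairwise close all lie near a common line through `0`. -/
theorem exists_common_slope (S : Finset (ℕ × ℕ)) (hS : ∀ x ∈ S, 0 < x.1 ∧ x.2 ≤ x.1)
    (hpair : ∀ x ∈ S, ∀ y ∈ S, x.2 * y.1 < y.2 * x.1 + x.1 + y.1) :
    ∃ r s : ℤ, IsCoprime r s ∧ 0 < r ∧ r < s ∧ ∀ x ∈ S, |(x.2 : ℤ) * s - x.1 * r| < s := by
  obtain ⟨m, hlo, hhi⟩ := Order.exists_between_finsets
    (insert (0 : ℚ) (S.image fun x => ((x.2 : ℚ) - 1) / x.1))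
    (insert (1 : ℚ) (S.image fun x => ((x.2 : ℚ) + 1) / x.1)) (by
      simp only [Finset.mem_insert, Finset.mem_image]
      rintro _ (rfl | ⟨x, hx, rfl⟩) _ (rfl | ⟨y, hy, rfl⟩)
      · exact one_pos
      · have h1 : (0 : ℚ) < y.1 := by exact_mod_cast (hS y hy).1
        positivity
      · have h1 : (0 : ℚ) < x.1 := by exact_mod_cast (hS x hx).1
        have h2 : (x.2 : ℚ) ≤ x.1 := by exact_mod_cast (hS x hx).2
        rw [div_lt_one h1]
        linarith
      · have h1 : (0 : ℚ) < x.1 := by exact_mod_cast (hS x hx).1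
        have h2 : (0 : ℚ) < y.1 := by exact_mod_cast (hS y hy).1
        have h3 : (x.2 : ℚ) * y.1 < y.2 * x.1 + x.1 + y.1 := by
          exact_mod_cast hpair x hx y hy
        rw [div_lt_div_iff₀ h1 h2]
        linarith)
  have hden : (0 : ℚ) < m.den := by exact_mod_cast m.den_pos
  have hm : m * m.den = m.num := Rat.mul_den_eq_num m
  refine ⟨m.num, m.den, ?_, ?_, ?_, ?_⟩
  · exact Int.isCoprime_iff_gcd_eq_one.mpr m.reduced
  · exact Rat.num_pos.mpr (hlo 0 (Finset.mem_insert_self _ _))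
  · have h1 := hhi 1 (Finset.mem_insert_self _ _)
    have : (m.num : ℚ) < m.den := by nlinarith
    exact_mod_cast this
  · intro x hx
    have h1 : (0 : ℚ) < x.1 := by exact_mod_cast (hS x hx).1
    have h2 := hlo _ (Finset.mem_insert_of_mem (Finset.mem_image_of_mem _ hx))
    have h3 := hhi _ (Finset.mem_insert_of_mem (Finset.mem_image_of_mem _ hx))
    rw [div_lt_iff₀ h1] at h2
    rw [lt_div_iff₀ h1] at h3
    have h4 := mul_lt_mul_of_pos_right h2 hden
    have h5 := mul_lt_mul_of_pos_right h3 hden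
    have h6 : |(x.2 : ℚ) * m.den - x.1 * m.num| < m.den := by
      rw [← hm, abs_lt]
      constructor <;> nlinarith
    exact_mod_cast h6

/-- The vector `(k, l)` has slope strictly between `0` and `1`, has `k` at least `M`, and every
point of `S` is within vertical distance `1` of the line through `0` it spans. -/
def GoodDirection (S : Finset (ℕ × ℕ)) (M k l : ℕ) : Prop :=
  M ≤ k ∧ 0 < l ∧ l < k ∧ ∀ x ∈ S, |(x.2 : ℤ) * k - x.1 * l| < k

theorem GoodDirection.add {S : Finset (ℕ × ℕ)} {M k l k' l' : ℕ}
    (h : GoodDirection S M k l) (h' : GoodDirection S M k' l') :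
    GoodDirection S M (k + k') (l + l') := by
  obtain ⟨a1, a2, a3, a4⟩ := h
  obtain ⟨b1, b2, b3, b4⟩ := h'
  refine ⟨by omega, by omega, by omega, fun x hx => ?_⟩
  have h1 := a4 x hx
  have h2 := b4 x hx
  rw [abs_lt] at *
  push_cast
  constructor <;> linarith

theorem exists_goodDirection_basis {S : Finset (ℕ × ℕ)} (N M : ℕ)
    (hN : ∀ x ∈ S, x.1 ≤ N ∧ x.2 ≤ N) {r s : ℤ} (hcop : IsCoprime r s) (hr : 0 < r)
    (hrs : r < s) (hS : ∀ x ∈ S, |(x.2 : ℤ) * s - x.1 * r| < s) :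
    ∃ k l k' l' : ℕ, l * k' = k * l' + 1 ∧ GoodDirection S M k l ∧ GoodDirection S M k' l' := by
  obtain ⟨a, y, hay⟩ := hcop
  obtain ⟨x, rfl⟩ : ∃ x, a = -x := ⟨-a, by ring⟩
  have hgood : ∀ j : ℤ, N * (|x| + |y|) + |x| + |y| + M + 1 ≤ j → ∃ k l : ℕ,
      (k : ℤ) = x + j * s ∧ (l : ℤ) = y + j * r ∧ GoodDirection S M k l := by
    intro j hj
    have hx0 := abs_nonneg x
    have hy0 := abs_nonneg y
    have hx1 := neg_abs_le x
    have hy1 := neg_abs_le y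
    have hx2 := le_abs_self x
    have hy2 := le_abs_self y
    have hNxy : 0 ≤ N * (|x| + |y|) := by positivity
    have hj0 : 0 ≤ j := by omega
    have hjs : j ≤ j * s := by nlinarith
    have hjr : j ≤ j * r := by nlinarith
    have hjsr : j * r + j ≤ j * s := by nlinarith
    refine ⟨(x + j * s).toNat, (y + j * r).toNat, Int.toNat_of_nonneg (by omega),
      Int.toNat_of_nonneg (by omega), by omega, by omega, by omega, fun z hz => ?_⟩
    rw [Int.toNat_of_nonneg (by omega), Int.toNat_of_nonneg (by omega)]
    have h1 := hS z hz
    have h2 : (z.1 : ℤ) ≤ N := by exact_mod_cast (hN z hz).1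
    have h3 : (z.2 : ℤ) ≤ N := by exact_mod_cast (hN z hz).2
    have h4 : |(z.2 : ℤ) * x - z.1 * y| ≤ N * (|x| + |y|) := by
      refine (abs_sub _ _).trans ?_
      rw [abs_mul, abs_mul, Nat.abs_cast, Nat.abs_cast]
      nlinarith
    have h5 : j * |(z.2 : ℤ) * s - z.1 * r| ≤ j * (s - 1) :=
      mul_le_mul_of_nonneg_left (by omega) hj0
    calc |(z.2 : ℤ) * (x + j * s) - z.1 * (y + j * r)|
        = |((z.2 : ℤ) * x - z.1 * y) + j * ((z.2 : ℤ) * s - z.1 * r)| := by ring_nf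
      _ ≤ |(z.2 : ℤ) * x - z.1 * y| + |j * ((z.2 : ℤ) * s - z.1 * r)| := abs_add_le _ _
      _ = |(z.2 : ℤ) * x - z.1 * y| + j * |(z.2 : ℤ) * s - z.1 * r| := by
        rw [abs_mul, abs_of_nonneg hj0]
      _ < x + j * s := by linarith
  obtain ⟨k, l, hk, hl, h⟩ := hgood _ le_rfl
  obtain ⟨k', l', hk', hl', h'⟩ := hgood _ (Int.le_add_one le_rfl)
  refine ⟨k, l, k', l', ?_, h, h'⟩
  zify
  rw [hk, hl, hk', hl']
  linear_combination hay

theorem exists_goodDirection_sum {S : Finset (ℕ × ℕ)} {M k l k' l' : ℕ}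
    (hdet : l * k' = k * l' + 1) (h : GoodDirection S M k l) (h' : GoodDirection S M k' l')
    {a b : ℕ} (hab : ¬ (a % 2 = 0 ∧ b % 2 = 0)) :
    ∃ k l k' l' : ℕ, l * k' = k * l' + 1 ∧ GoodDirection S M k l ∧ GoodDirection S M k' l' ∧
      (k + k') % 2 = a % 2 ∧ (l + l') % 2 = b % 2 := by
  have hpar : l * k' % 2 = (k * l' + 1) % 2 := by rw [hdet]
  rw [Nat.add_mod, Nat.mul_mod l, Nat.mul_mod k] at hpar
  have hcases : ((k + k') % 2 = a % 2 ∧ (l + l') % 2 = b % 2) ∨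
      (k' % 2 = a % 2 ∧ l' % 2 = b % 2) ∨ (k % 2 = a % 2 ∧ l % 2 = b % 2) := by
    rcases Nat.mod_two_eq_zero_or_one k with x1 | x1 <;>
      rcases Nat.mod_two_eq_zero_or_one l with x2 | x2 <;>
      rcases Nat.mod_two_eq_zero_or_one k' with x3 | x3 <;>
      rcases Nat.mod_two_eq_zero_or_one l' with x4 | x4 <;>
      rw [x1, x2, x3, x4] at hpar <;> norm_num at hpar <;> omega
  rcases hcases with hc | hc | hc
  · exact ⟨k, l, k', l', hdet, h, h', hc⟩
  · exact ⟨k, l, k + k', l + l', by linarith, h, h.add h', by omega, by omega⟩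
  · exact ⟨k + k', l + l', k', l', by linarith, h.add h', h', by omega, by omega⟩

theorem eq_incrementWord (W : List Bool) :
    W = incrementWord (fun i => (W.take i).count true) W.length := by
  refine List.ext_getElem (by simp [incrementWord]) fun i h1 h2 => ?_
  simp only [incrementWord, List.getElem_map, List.getElem_range]
  rw [← List.take_concat_get' W i h1, List.count_append]
  cases W[i] <;> simp

theorem Pal.count_take {W : List Bool} (hpal : Pal W) {i : ℕ} (hi : i ≤ W.length) :
    (W.take i).count true + (W.take (W.length - i)).count true = W.count true := by
  have h1 : W.take (W.length - i) = (W.drop i).reverse := by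
    conv_lhs => rw [← show W.reverse = W from hpal]
    rw [List.take_reverse]
    congr 2
    simp
    omega
  rw [h1, List.count_reverse, ← List.count_append, List.take_append_drop]

/-- A palindrome whose graph stays close to the line of slope `p / q` through its centre
is a central segment of the central word of that slope. -/
theorem Pal.infix_centralWord {W : List Bool} {p q : ℕ} (hq : W.length + 2 ≤ q)
    (hqN : q % 2 = W.length % 2) (hpH : p % 2 = (W.count true + 1) % 2)
    (hclose : ∀ i ≤ W.length, |(2 * ((W.take i).count true : ℤ) - W.count true) * q -
      (2 * i - W.length) * p| < q) :
    W <:+: centralWord p q := by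
  obtain ⟨s, hs⟩ : ∃ s, q = W.length + 2 * s + 2 := ⟨(q - W.length - 2) / 2, by omega⟩
  have hF : ∀ i ≤ W.length, 2 * ((((s + i) + 1) * p / q : ℕ) : ℤ) =
      2 * (W.take i).count true - W.count true + p - 1 := by
    intro i hi
    have h := abs_lt.mp (hclose i hi)
    have hdm := Nat.div_add_mod ((s + i + 1) * p) q
    have hr := Nat.mod_lt ((s + i + 1) * p) (by omega : 0 < q)
    generalize (s + i + 1) * p / q = f at *
    generalize (s + i + 1) * p % q = r at *
    have hq0 : (0 : ℤ) < q := by omega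
    have hs' : (q : ℤ) = W.length + 2 * s + 2 := by exact_mod_cast hs
    have hdm' : (q : ℤ) * f + r = (s + i + 1) * p := by exact_mod_cast hdm
    have hr' : (r : ℤ) < q := by exact_mod_cast hr
    have hr0 : (0 : ℤ) ≤ r := by positivity
    have hmid : (q + (2 * i - W.length)) * p = 2 * ((q : ℤ) * f + r) := by
      rw [hdm', hs']; ring
    generalize hg : (2 * ((W.take i).count true : ℤ) - W.count true) = g at *
    have h1 : (q : ℤ) * (g + p - 1) < q * (2 * f + 2) := by nlinarith
    have h2 : (q : ℤ) * (2 * f) < q * (g + p + 1) := by nlinarith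
    have h3 := lt_of_mul_lt_mul_left h1 hq0.le
    have h4 := lt_of_mul_lt_mul_left h2 hq0.le
    omega
  have hseg : W = incrementWord (fun i => ((s + i) + 1) * p / q) W.length := by
    conv_lhs => rw [eq_incrementWord W]
    refine List.map_congr_left fun i hi => ?_
    rw [List.mem_range] at hi
    have h1 := hF i (by omega)
    have h2 := hF (i + 1) (by omega)
    rw [decide_eq_decide]
    beta_reduce
    omega
  rw [hseg]
  exact incrementWord_shift_infix (fun i => (i + 1) * p / q) (by omega)

/-- A balanced palindrome is a factor of a rich word, hence is itself rich. -/
theorem BalancedWord.card_palFactorFinset_of_pal {W : List Bool} (hbal : BalancedWord W)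
    (hpal : Pal W) : (palFactorFinset W).card = W.length + 1 := by
  refine le_antisymm (card_palFactorFinset_le W) ?_
  set N := W.length with hN
  let mid : ℕ → List Bool := fun i => (W.take i).drop (N - i)
  have hmid : ∀ i, mid i <:+: W := fun i =>
    (List.drop_suffix _ _).isInfix.trans (List.take_prefix _ _).isInfix
  have hlen : ∀ i ≤ N, (mid i).length = i - (N - i) := fun i hi => by
    simp [mid]; omega
  have hcount : ∀ i ≤ N, N ≤ 2 * i →
      W.count true + (mid i).count true = 2 * (W.take i).count true := by
    intro i hi hi2
    have h1 := hpal.count_take hi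
    rw [← hN] at h1
    have h2 : (W.take (N - i)).count true + (mid i).count true = (W.take i).count true := by
      rw [← List.count_append]
      congr 1
      conv_rhs => rw [← List.take_append_drop (N - i) (W.take i)]
      rw [List.take_take, min_eq_left (by omega)]
    omega
  let S : Finset (ℕ × ℕ) := ((Finset.range (N + 1)).filter fun i => N < 2 * i).image
    fun i => ((mid i).length, (mid i).count true)
  have hSmem : ∀ x ∈ S, ∃ i ≤ N, N < 2 * i ∧ x = ((mid i).length, (mid i).count true) := by
    intro x hx
    obtain ⟨i, hi, rfl⟩ := Finset.mem_image.mp hx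
    rw [Finset.mem_filter, Finset.mem_range] at hi
    exact ⟨i, by omega, hi.2, rfl⟩
  have hpos : ∀ x ∈ S, 0 < x.1 ∧ x.2 ≤ x.1 := by
    intro x hx
    obtain ⟨i, hi, hi2, rfl⟩ := hSmem x hx
    exact ⟨by dsimp only; rw [hlen i hi]; omega, List.count_le_length⟩
  have hpair : ∀ x ∈ S, ∀ y ∈ S, x.2 * y.1 < y.2 * x.1 + x.1 + y.1 := by
    intro x hx y hy
    have hx0 := (hpos x hx).1
    have hy0 := (hpos y hy).1
    obtain ⟨i, -, -, rfl⟩ := hSmem x hx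
    obtain ⟨j, -, -, rfl⟩ := hSmem y hy
    exact hbal.slope_lt (hmid i) (hmid j) hx0 hy0
  have hle : ∀ x ∈ S, x.1 ≤ N ∧ x.2 ≤ N := by
    intro x hx
    have h1 := (hpos x hx).2
    obtain ⟨i, -, -, rfl⟩ := hSmem x hx
    have := (hmid i).length_le
    dsimp only at h1 ⊢
    omega
  obtain ⟨r, s, hcop, hr, hrs, hS⟩ := exists_common_slope S hpos hpair
  obtain ⟨k₀, l₀, k₀', l₀', hdet₀, hg₀, hg₀'⟩ :=
    exists_goodDirection_basis N (N + 2) hle hcop hr hrs hS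
  obtain ⟨k, l, k', l', hdet, hg, hg', hk, hl⟩ :=
    exists_goodDirection_sum (a := N) (b := W.count true + 1) hdet₀ hg₀ hg₀' (by
      have := hpal.count_even
      omega)
  have hsum := hg.add hg'
  refine card_palFactorFinset_of_infix (Pal.infix_centralWord hsum.1 hk hl ?_)
    (centralWord_rich hdet hg.2.1 hg.2.2.1 hg'.2.1 hg'.2.2.1)
  have hupper : ∀ i ≤ N, N < 2 * i →
      |(2 * ((W.take i).count true : ℤ) - W.count true) * (k + k' : ℕ) -
        (2 * i - N) * (l + l' : ℕ)| < (k + k' : ℕ) := by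
    intro i hi hi2
    have h := hsum.2.2.2 _ (Finset.mem_image_of_mem _
      (Finset.mem_filter.mpr ⟨Finset.mem_range.mpr (Nat.lt_succ_of_le hi), hi2⟩))
    have h1 := hcount i hi hi2.le
    have h2 := hlen i hi
    dsimp only at h
    rwa [show ((mid i).length : ℤ) = 2 * i - N by omega,
      show ((mid i).count true : ℤ) = 2 * (W.take i).count true - W.count true by omega] at h
  intro i hi
  have hsym := hpal.count_take hi
  rw [← hN] at hsym hi ⊢
  rcases lt_trichotomy N (2 * i) with h | h | h
  · exact hupper i hi h
  · have h1 : N - i = i := by omega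
    rw [h1] at hsym
    rw [show 2 * ((W.take i).count true : ℤ) - W.count true = 0 by omega,
      show (2 * (i : ℤ) - N) = 0 by omega]
    have := hsum.2.2.1
    simp only [zero_mul, sub_zero, abs_zero]
    omega
  · have h1 := hupper (N - i) (by omega) (by omega)
    rw [← abs_neg] at h1
    convert h1 using 2
    rw [show ((W.take (N - i)).count true : ℤ) = W.count true - (W.take i).count true by omega,
      Nat.cast_sub hi]
    ring

theorem stmt12 (W : List Bool) (hbal : BalancedWord W) (hpal : Pal W) :
    ∀ n : ℕ, n ≤ W.length → P W n + P W (W.length - n) = 2 :=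
  fun _ hn => hbal.P_add_P_of_rich hpal (hbal.card_palFactorFinset_of_pal hpal) hn
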